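/- arXiv:2103.15380 — 5 statements merged into one kernel-verified Lean document; each statement's English description precedes it below -/
import Mathlib

section
/- Let a ≥ 1, n ≥ 1 and d ≥ 2 be integers. Then ((a·n + 1)·(d − 1) + 2) divides 2·n if and only if a = 1, n = 3 and d = 2. -/
theorem condition_a_iff (a n d : ℕ) (ha : 1 ≤ a) (hn : 1 ≤ n) (hd : 2 ≤ d) :
    ((a * n + 1) * (d - 1) + 2) ∣ 2 * n ↔ a = 1 ∧ n = 3 ∧ d = 2 := by
  constructor
  · rintro ⟨k, hk⟩
    obtain ⟨e, rfl⟩ : ∃ e, d = e + 2 := ⟨d - 2, by omega⟩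
    rw [show e + 2 - 1 = e + 1 by omega] at hk
    have han : n ≤ a * n := Nat.le_mul_of_pos_left n ha
    have hle : a * n + 1 ≤ (a * n + 1) * (e + 1) := Nat.le_mul_of_pos_right _ e.succ_pos
    have hk_pos : k ≠ 0 := by
      rintro rfl
      omega
    have hk_lt : k < 2 := by
      by_contra! h
      have := Nat.mul_le_mul_left ((a * n + 1) * (e + 1) + 2) h
      omega
    obtain rfl : k = 1 := by omega
    have hae : a * (e + 1) < 2 := by
      by_contra! h
      have := Nat.mul_le_mul_right n h
      nlinarith
    have he : e = 0 := by nlinarith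
    subst he
    obtain rfl : a = 1 := by omega
    omega
  · rintro ⟨rfl, rfl, rfl⟩
    norm_num
end

section
/- Let a ≥ 1, n ≥ 1 and d ≥ 2 be integers, and set t = gcd(d+1, 2·a·n). If ((a·n + 1)·(d − 1) + 2) divides t·n, then either (a, n, d) = (2, 3, 2) or a = 1. -/
theorem condition_b_implies (a n d : ℕ) (ha : 1 ≤ a) (hn : 1 ≤ n) (hd : 2 ≤ d)
    (h : ((a * n + 1) * (d - 1) + 2) ∣ Nat.gcd (d + 1) (2 * a * n) * n) :
    (a = 2 ∧ n = 3 ∧ d = 2) ∨ a = 1 := by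
  have ht : Nat.gcd (d + 1) (2 * a * n) ≤ d + 1 := Nat.gcd_le_left _ (by omega)
  have ht₀ : 0 < Nat.gcd (d + 1) (2 * a * n) := Nat.gcd_pos_of_pos_left _ (by omega)
  have hle : (a * n + 1) * (d - 1) + 2 ≤ (d + 1) * n :=
    (Nat.le_of_dvd (Nat.mul_pos ht₀ hn) h).trans (Nat.mul_le_mul_right n ht)
  obtain ⟨b, rfl⟩ := Nat.exists_eq_add_of_le' ha
  obtain ⟨e, rfl⟩ := Nat.exists_eq_add_of_le' (one_le_two.trans hd)
  rw [Nat.add_sub_cancel] at hle h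
  have hbe : b * e < 2 := by
    by_contra! hbe
    nlinarith [Nat.mul_le_mul_right n hbe]
  rcases Nat.eq_zero_or_pos b with rfl | hb
  · exact Or.inr rfl
  obtain rfl : b = 1 := by nlinarith
  obtain rfl : e = 1 := by omega
  left
  obtain ⟨k, hk⟩ := h
  have hk_one : k = 1 := by
    have hk_pos : k ≠ 0 := by
      rintro rfl
      exact (Nat.mul_pos ht₀ hn).ne' hk
    by_contra hne
    have hk_two : 2 ≤ k := by omega
    nlinarith [Nat.mul_le_mul_right n ht]
  subst hk_one
  generalize Nat.gcd (1 + 1 + 1) (2 * (1 + 1) * n) = t at *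
  interval_cases t <;> omega
end

section
/- Let b ≥ 1 and d ≥ 2 be integers. Then (b·(d−1) + 2) divides b·(d+1) if and only if b = 1, or d = 2 and b = 4. -/
theorem divisibility_classification (b d : ℕ) (hb : 1 ≤ b) (hd : 2 ≤ d) :
    (b * (d - 1) + 2) ∣ b * (d + 1) ↔ b = 1 ∨ (d = 2 ∧ b = 4) := by
  obtain ⟨k, rfl⟩ := Nat.exists_eq_add_of_le hd
  rw [show 2 + k - 1 = k + 1 by omega, show 2 + k + 1 = k + 3 by omega]
  constructor
  · rintro ⟨c, hc⟩
    have hc3 : c < 3 := by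
      by_contra! h
      have := Nat.mul_le_mul_left (b * (k + 1) + 2) h
      nlinarith [Nat.zero_le (b * k)]
    interval_cases c
    · nlinarith [Nat.zero_le (b * k)]
    · left
      linarith
    · right
      have hbk : b = b * k + 4 := by linarith
      have hk : k = 0 := by
        by_contra h
        have := Nat.mul_le_mul_left b (Nat.one_le_iff_ne_zero.mpr h)
        omega
      subst hk
      omega
  · rintro (rfl | ⟨h, rfl⟩)
    · exact ⟨1, by ring⟩
    · obtain rfl : k = 0 := by omega
      exact ⟨2, rfl⟩
end

section
/- Let n ≥ 1 and d ≥ 2 be integers. Then both (d+1) divides 2·n and ((n+1)·(d−1) + 2) divides (d+1)·n hold if and only if d = 2·n − 1, or d = 2 and n = 6. -/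
theorem eq_one_or_of_mul_add_two_dvd {b e : ℕ} (hb : 1 ≤ b) (he : 1 ≤ e)
    (h : b * e + 2 ∣ b * (e + 2)) : b = 1 ∨ (e = 1 ∧ b = 4) := by
  have hdvd : b * e + 2 ∣ 2 * b - 2 := by
    have h_sub := Nat.dvd_sub h (dvd_refl (b * e + 2))
    rwa [show b * (e + 2) - (b * e + 2) = 2 * b - 2 by rw [mul_add]; omega] at h_sub
  rcases hb.eq_or_lt with rfl | hb
  · exact Or.inl rfl
  have hle := Nat.le_of_dvd (by omega) hdvd
  obtain rfl : e = 1 := by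
    by_contra hne
    have : b * 2 ≤ b * e := Nat.mul_le_mul_left b (by omega)
    omega
  obtain ⟨k, hk⟩ := hdvd
  have hk2 : k < 2 := by
    by_contra! hk2
    have := Nat.mul_le_mul_left (b * 1 + 2) hk2
    omega
  interval_cases k <;> omega

theorem case_a_eq_one (n d : ℕ) (hn : 1 ≤ n) (hd : 2 ≤ d) :
    ((d + 1) ∣ 2 * n ∧ ((n + 1) * (d - 1) + 2) ∣ (d + 1) * n) ↔
      (d = 2 * n - 1 ∨ (d = 2 ∧ n = 6)) := by
  obtain ⟨e, rfl⟩ : ∃ e, d = e + 1 := ⟨d - 1, by omega⟩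
  rw [Nat.add_sub_cancel]
  constructor
  · rintro ⟨⟨b, hb⟩, h⟩
    have hb1 : 1 ≤ b := by
      rcases Nat.eq_zero_or_pos b with rfl | hb1 <;> omega
    have h2 : (e + 2) * (b * e + 2) ∣ (e + 2) * (b * (e + 2)) := by
      rw [show (e + 2) * (b * e + 2) = 2 * ((n + 1) * e + 2) by linear_combination e * hb.symm,
        show (e + 2) * (b * (e + 2)) = 2 * ((e + 1 + 1) * n) by
          linear_combination (e + 2) * hb.symm]
      exact mul_dvd_mul_left 2 h
    rcases eq_one_or_of_mul_add_two_dvd hb1 (by omega)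
      (Nat.dvd_of_mul_dvd_mul_left (by omega) h2) with rfl | ⟨rfl, rfl⟩ <;> omega
  · rintro (h | ⟨h, rfl⟩)
    · have h2 : e + 1 + 1 = 2 * n := by omega
      refine ⟨h2.dvd, 1, ?_⟩
      linear_combination h2.symm
    · obtain rfl : e = 1 := by omega
      decide
end

section
/- Let a ≥ 1, n ≥ 1 and d ≥ 2 be integers, and set D = (a·n + 1)·(d − 1) + 2. Then [D divides 2·n] or [(d+1) divides 2·n and D divides (d+1)·n] holds if and only if (a, n, d) belongs to the set {(1, t, 2t−1) : t ≥ 2} ∪ {(1, 3, 2), (1, 6, 2), (2, 3, 2)}. -/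
theorem nakayama_classification (a n d : ℕ) (ha : 1 ≤ a) (hn : 1 ≤ n) (hd : 2 ≤ d) :
    (((a * n + 1) * (d - 1) + 2) ∣ 2 * n ∨
        ((d + 1) ∣ 2 * n ∧ ((a * n + 1) * (d - 1) + 2) ∣ (d + 1) * n)) ↔
      ((∃ t, 2 ≤ t ∧ a = 1 ∧ n = t ∧ d = 2 * t - 1) ∨
        (a = 1 ∧ n = 3 ∧ d = 2) ∨ (a = 1 ∧ n = 6 ∧ d = 2) ∨
        (a = 2 ∧ n = 3 ∧ d = 2)) := by
  obtain ⟨e, rfl⟩ : ∃ e, d = e + 1 := ⟨d - 1, by omega⟩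
  have he : 1 ≤ e := by omega
  rw [Nat.add_sub_cancel]
  constructor
  · rintro (⟨k, hk⟩ | ⟨-, k, hk⟩)
    · have hk1 : 1 ≤ k := Nat.pos_of_ne_zero (by rintro rfl; omega)
      have hlt : n * (k * a * e) < n * 2 := by nlinarith [Nat.mul_pos hk1 he]
      have h1 : k * (a * e) = 1 := by
        have := Nat.lt_of_mul_lt_mul_left hlt
        have := Nat.mul_pos hk1 (Nat.mul_pos ha he)
        rw [← mul_assoc] at *
        omega
      obtain ⟨rfl, h2⟩ := mul_eq_one.mp h1
      obtain ⟨rfl, rfl⟩ := mul_eq_one.mp h2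
      omega
    · have hk1 : 1 ≤ k := Nat.pos_of_ne_zero (by rintro rfl; simp at hk; omega)
      have hlt : n * (k * a * e) < n * (e + 2) := by nlinarith [Nat.mul_pos hk1 he]
      have hlt' := Nat.lt_of_mul_lt_mul_left hlt
      have hka : k * a ≤ 2 := by
        by_contra! h
        nlinarith
      have hk2 : k ≤ 2 := by nlinarith
      have ha2 : a ≤ 2 := by nlinarith
      interval_cases k <;> interval_cases a
      · exact Or.inl ⟨n, by nlinarith, rfl, rfl, by
          have : e + 2 = 2 * n := by nlinarith
          omega⟩
      · obtain rfl : e = 1 := by omega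
        omega
      · obtain rfl : e = 1 := by omega
        omega
      · omega
  · rintro (⟨t, ht, rfl, rfl, h⟩ | ⟨rfl, rfl, h⟩ | ⟨rfl, rfl, h⟩ | ⟨rfl, rfl, h⟩)
    · obtain ⟨s, rfl⟩ : ∃ s, n = s + 1 := ⟨n - 1, by omega⟩
      obtain rfl : e = 2 * s := by omega
      exact Or.inr ⟨⟨1, by ring⟩, ⟨1, by ring⟩⟩
    all_goals
      obtain rfl : e = 1 := by omega
      decide
end
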